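/- Suppose β > β₂^m = e^{λ_m(A)}. Then there exists a measurable function Δ_β : Θ×𝕋 → [0,1] such that F_{β,θ,α}(Δ_β(θ,α)) ≥ Δ_β(g(θ,α)) for all θ ∈ Θ and α ∈ 𝕋, and the set {θ ∈ Θ : α ↦ Δ_β(θ,α) is continuous and strictly positive} has full m-measure. -/

import Mathlib

open Filter MeasureTheory Metric Set
open scoped Topology

noncomputable section

/-- ℝ² with the Euclidean norm. -/
abbrev R2 : Type := EuclideanSpace ℝ (Fin 2)

/-- Action of a 2×2 real matrix on Euclidean ℝ². -/
def mulVecE (M : Matrix (Fin 2) (Fin 2) ℝ) (v : R2) : R2 :=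
  (WithLp.equiv 2 (Fin 2 → ℝ)).symm (M.mulVec ((WithLp.equiv 2 (Fin 2 → ℝ)) v))

/-- Operator norm of a 2×2 real matrix induced by the Euclidean norm on ℝ². -/
def opNorm (M : Matrix (Fin 2) (Fin 2) ℝ) : ℝ :=
  ‖(Matrix.toEuclideanCLM (𝕜 := ℝ) M : R2 →L[ℝ] R2)‖

/-- The cocycle `A_n(θ) = A(γ^{n-1}θ) ⋯ A(θ)`. -/
def coc {Θ : Type*} (γ : Θ → Θ) (A : Θ → Matrix (Fin 2) (Fin 2) ℝ) :
    ℕ → Θ → Matrix (Fin 2) (Fin 2) ℝ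
  | 0, _ => 1
  | n + 1, θ => coc γ A n (γ θ) * A θ

/-- Maximal Lyapunov exponent `λ_max(A) = sup_θ limsup (1/n) log‖A_n(θ)‖`. -/
def lyapMax {Θ : Type*} (γ : Θ → Θ) (A : Θ → Matrix (Fin 2) (Fin 2) ℝ) : ℝ :=
  ⨆ θ : Θ, Filter.limsup (fun n : ℕ => Real.log (opNorm (coc γ A n θ)) / n) Filter.atTop

/-- The hypotheses on `h`: C² on [0,∞), strictly increasing, strictly concave, bounded,
nonnegative, `h 0 = 0`, `h' 0 = 1`. -/
def GoodH (h : ℝ → ℝ) : Prop :=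
  ContDiffOn ℝ 2 h (Set.Ici 0) ∧ StrictMonoOn h (Set.Ici 0) ∧
    StrictConcaveOn ℝ (Set.Ici 0) h ∧ BddAbove (h '' Set.Ici 0) ∧
    (∀ x ∈ Set.Ici (0 : ℝ), 0 ≤ h x) ∧ h 0 = 0 ∧ derivWithin h (Set.Ici 0) 0 = 1

/-- The scaling condition `sup_{x ≥ 0} h(x) ≤ (sup_θ ‖A(θ)‖)⁻¹`. -/
def Scaled {Θ : Type*} (A : Θ → Matrix (Fin 2) (Fin 2) ℝ) (h : ℝ → ℝ) : Prop :=
  ∀ x ∈ Set.Ici (0 : ℝ), h x ≤ (⨆ θ : Θ, opNorm (A θ))⁻¹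

open scoped Classical in
/-- The fibre maps `f_{β,θ}(v) = h(β‖v‖)·A(θ)·v/‖v‖`, `f_{β,θ}(0) = 0`. -/
def fibMap {Θ : Type*} (A : Θ → Matrix (Fin 2) (Fin 2) ℝ) (h : ℝ → ℝ) (β : ℝ)
    (θ : Θ) (v : R2) : R2 :=
  if v = 0 then 0 else (h (β * ‖v‖) / ‖v‖) • mulVecE (A θ) v

/-- The skew product `f_β(θ,v) = (γθ, f_{β,θ}(v))`. -/
def skewProd {Θ : Type*} (γ : Θ → Θ) (A : Θ → Matrix (Fin 2) (Fin 2) ℝ) (h : ℝ → ℝ)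
    (β : ℝ) : Θ × R2 → Θ × R2 :=
  fun p => (γ p.1, fibMap A h β p.1 p.2)

/-- The global attractor `𝒜_β = ⋂_{n∈ℕ} f_β^n(Θ × B̄₁(0))`. -/
def globalAttractor {Θ : Type*} (γ : Θ → Θ) (A : Θ → Matrix (Fin 2) (Fin 2) ℝ)
    (h : ℝ → ℝ) (β : ℝ) : Set (Θ × R2) :=
  ⋂ n : ℕ, (skewProd γ A h β)^[n] '' (Set.univ ×ˢ Metric.closedBall (0 : R2) 1)

/-- The fibre `𝒜_β(θ) = {x : (θ,x) ∈ 𝒜_β}` of the global attractor. -/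
def attractorFib {Θ : Type*} (γ : Θ → Θ) (A : Θ → Matrix (Fin 2) (Fin 2) ℝ)
    (h : ℝ → ℝ) (β : ℝ) (θ : Θ) : Set R2 :=
  {x : R2 | (θ, x) ∈ globalAttractor γ A h β}

/-- `v(α) = (cos 2πα, sin 2πα)ᵗ`. -/
def vFull (α : ℝ) : R2 :=
  (WithLp.equiv 2 (Fin 2 → ℝ)).symm ![Real.cos (2 * Real.pi * α), Real.sin (2 * Real.pi * α)]

/-- `(cos πα, sin πα)ᵗ`, representing the projective point `α ∈ 𝕋 ≅ ℝP¹`. -/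
def vHalf (α : ℝ) : R2 :=
  (WithLp.equiv 2 (Fin 2 → ℝ)).symm ![Real.cos (Real.pi * α), Real.sin (Real.pi * α)]

/-- The projective angle coordinate `p(w) = (1/π)·arg(w) mod 1 ∈ [0,1)` of a nonzero
vector `w ∈ ℝ²`; for `w ≠ 0` this equals `(1/π)·arctan(w₂/w₁) mod 1`. -/
def projAngle (w : R2) : ℝ :=
  Int.fract (Complex.arg (Complex.ofReal (w 0) + Complex.ofReal (w 1) * Complex.I) / Real.pi)

/-- The projective action `g(θ,α) = (γθ, g_θ(α))` of the cocycle on `Θ × 𝕋`,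
where `𝕋` is modelled by the fundamental domain `[0,1) ⊆ ℝ`. -/
def gMap {Θ : Type*} (γ : Θ → Θ) (A : Θ → Matrix (Fin 2) (Fin 2) ℝ) :
    Θ × ℝ → Θ × ℝ :=
  fun p => (γ p.1, projAngle (mulVecE (A p.1) (vHalf p.2)))

/-- `Ω(θ,α) = ‖A(θ)(cos πα, sin πα)ᵗ‖`. -/
def Omega {Θ : Type*} (A : Θ → Matrix (Fin 2) (Fin 2) ℝ) (p : Θ × ℝ) : ℝ :=
  ‖mulVecE (A p.1) (vHalf p.2)‖

/-- The fibre maps `F_{β,θ,α}(r) = h(βr)·Ω(θ,α)` of the double skew product. -/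
def dsFib {Θ : Type*} (A : Θ → Matrix (Fin 2) (Fin 2) ℝ) (h : ℝ → ℝ) (β : ℝ)
    (p : Θ × ℝ) (r : ℝ) : ℝ :=
  h (β * r) * Omega A p

/-- The double skew product `F_β(θ,α,r) = (g(θ,α), h(βr)·Ω(θ,α))` on `Θ × 𝕋 × [0,∞)`. -/
def dsMap {Θ : Type*} (γ : Θ → Θ) (A : Θ → Matrix (Fin 2) (Fin 2) ℝ) (h : ℝ → ℝ)
    (β : ℝ) : Θ × ℝ × ℝ → Θ × ℝ × ℝ :=
  fun p => ((gMap γ A (p.1, p.2.1)).1, (gMap γ A (p.1, p.2.1)).2, dsFib A h β (p.1, p.2.1) p.2.2)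

/-- `Ω_n(θ,α) = ∏_{i=0}^{n-1} Ω(g^i(θ,α))`. -/
def OmegaProd {Θ : Type*} (γ : Θ → Θ) (A : Θ → Matrix (Fin 2) (Fin 2) ℝ) (n : ℕ)
    (p : Θ × ℝ) : ℝ :=
  ∏ i ∈ Finset.range n, Omega A ((gMap γ A)^[i] p)

/-- `Γ(a,b) = inf_{a ≤ x ≤ 1} inf_{0 < q ≤ b} h(qx)/(q·h(x))`. -/
def GammaH (h : ℝ → ℝ) (a b : ℝ) : ℝ :=
  sInf {y : ℝ | ∃ x ∈ Set.Icc a 1, ∃ q ∈ Set.Ioc (0 : ℝ) b, y = h (q * x) / (q * h x)}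

/-- The inverse `g⁻¹(θ,α) = (γ⁻¹θ, projective angle of A(γ⁻¹θ)⁻¹·v(α))` of the
projective action. -/
def gInv {Θ : Type*} (γinv : Θ → Θ) (A : Θ → Matrix (Fin 2) (Fin 2) ℝ) :
    Θ × ℝ → Θ × ℝ :=
  fun p => (γinv p.1, projAngle (mulVecE (A (γinv p.1))⁻¹ (vHalf p.2)))

/-- `F^n_{β,g^{-n}(θ,α)}(1)`, the pullback iterate defining the upper bounding graph. -/
def pullback1 {Θ : Type*} (γ : Θ → Θ) (γinv : Θ → Θ) (A : Θ → Matrix (Fin 2) (Fin 2) ℝ)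
    (h : ℝ → ℝ) (β : ℝ) (n : ℕ) (p : Θ × ℝ) : ℝ :=
  ((dsMap γ A h β)^[n] (((gInv γinv A)^[n] p).1, ((gInv γinv A)^[n] p).2, 1)).2.2


/-- `posPartMax S φ n = max (0, S₁ φ, …, Sₙ φ)`, where `Sₖ φ` are the Birkhoff sums of `φ`
along `S`. -/
def posPartMax {Θ : Type*} (S : Θ → Θ) (φ : Θ → ℝ) : ℕ → Θ → ℝ
  | 0, _ => 0
  | n + 1, θ => max 0 (φ θ + posPartMax S φ n (S θ))

section PosPartMax

variable {Θ : Type*} {S : Θ → Θ} {φ : Θ → ℝ}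

lemma posPartMax_nonneg (n : ℕ) (θ : Θ) : 0 ≤ posPartMax S φ n θ := by
  cases n with
  | zero => exact le_rfl
  | succ n => exact le_max_left _ _

lemma posPartMax_le_succ (n : ℕ) (θ : Θ) : posPartMax S φ n θ ≤ posPartMax S φ (n + 1) θ := by
  induction n generalizing θ with
  | zero => exact posPartMax_nonneg _ _
  | succ n ih => exact max_le_max le_rfl (add_le_add le_rfl (ih (S θ)))

lemma posPartMax_le {D : ℝ} (hD : ∀ θ, |φ θ| ≤ D) (n : ℕ) (θ : Θ) :
    posPartMax S φ n θ ≤ n * D := by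
  induction n generalizing θ with
  | zero => simp [posPartMax]
  | succ n ih =>
    have h0 : 0 ≤ D := (abs_nonneg _).trans (hD θ)
    have h1 := (le_abs_self _).trans (hD θ)
    have h2 := ih (S θ)
    refine max_le (by positivity) ?_
    push_cast
    linarith

variable [MeasurableSpace Θ]

lemma measurable_posPartMax (hS : Measurable S) (hφ : Measurable φ) (n : ℕ) :
    Measurable (posPartMax S φ n) := by
  induction n with
  | zero => exact measurable_const
  | succ n ih => exact measurable_const.max (hφ.add (ih.comp hS))

/-- A form of the maximal ergodic theorem: if the Birkhoff sums of `φ` are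
almost everywhere unbounded above, then `φ` has nonnegative integral. -/
lemma integral_nonneg_of_tendsto_posPartMax {m : Measure Θ} [IsProbabilityMeasure m]
    (hS : MeasurePreserving S m m) (hφ : Measurable φ) {D : ℝ} (hD : ∀ θ, |φ θ| ≤ D)
    (hlim : ∀ᵐ θ ∂m, Tendsto (fun n => posPartMax S φ n θ) atTop atTop) :
    0 ≤ ∫ θ, φ θ ∂m := by
  have hmeas := measurable_posPartMax hS.measurable hφ
  have hint (n : ℕ) : Integrable (posPartMax S φ n) m := by
    refine Integrable.of_bound (hmeas n).aestronglyMeasurable (n * D) (.of_forall fun θ => ?_)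
    rw [Real.norm_of_nonneg (posPartMax_nonneg n θ)]
    exact posPartMax_le hD n θ
  have hdiff (n : ℕ) (θ : Θ) : posPartMax S φ (n + 1) θ - posPartMax S φ n (S θ) =
      max (-posPartMax S φ n (S θ)) (φ θ) := by
    rw [posPartMax, ← max_sub_sub_right, zero_sub, add_sub_cancel_right]
  have hconv : Tendsto
      (fun n => ∫ θ, (posPartMax S φ (n + 1) θ - posPartMax S φ n (S θ)) ∂m)
      atTop (𝓝 (∫ θ, φ θ ∂m)) := by
    refine tendsto_integral_of_dominated_convergence (fun _ => D)
      (fun n => ((hmeas (n + 1)).sub ((hmeas n).comp hS.measurable)).aestronglyMeasurable)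
      (integrable_const _) (fun n => .of_forall fun θ => ?_) ?_
    · have h1 := abs_le.1 (hD θ)
      have h2 := posPartMax_nonneg (S := S) (φ := φ) n (S θ)
      rw [hdiff, Real.norm_eq_abs, abs_le]
      exact ⟨h1.1.trans (le_max_right _ _), max_le (by linarith) h1.2⟩
    · filter_upwards [hS.quasiMeasurePreserving.ae hlim] with θ hθ
      refine tendsto_const_nhds.congr' ?_
      filter_upwards [hθ.eventually_ge_atTop (-φ θ)] with n hn
      rw [hdiff, max_eq_right (by linarith)]
  refine ge_of_tendsto' hconv fun n => ?_
  have hcomp : ∫ θ, posPartMax S φ n (S θ) ∂m = ∫ θ, posPartMax S φ n θ ∂m := by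
    conv_rhs => rw [← hS.map_eq]
    rw [integral_map hS.aemeasurable (hmeas n).aestronglyMeasurable]
  have hintS : Integrable (fun θ => posPartMax S φ n (S θ)) m :=
    hS.integrable_comp_of_integrable (hint n)
  rw [integral_sub (hint _) hintS, hcomp, sub_nonneg]
  exact integral_mono (hint n) (hint _) (posPartMax_le_succ n)

/-- The upper half of Kingman's theorem for a subadditive process with bounded increments:
if `∫ f N < N c` for some `N`, then `f n - n c` is almost surely bounded above. -/
lemma ae_bddAbove_sub_of_subadditive {m : Measure Θ} [IsProbabilityMeasure m] {T : Θ → Θ}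
    (hT : Ergodic T m) {f : ℕ → Θ → ℝ} (hf : ∀ n, Measurable (f n)) (hf0 : ∀ θ, f 0 θ = 0)
    (hpos : ∀ n θ, 0 ≤ f n θ) {L : ℝ} (hL : ∀ θ, f 1 θ ≤ L)
    (hsub : ∀ n k θ, f (n + k) θ ≤ f n θ + f k (T^[n] θ))
    {N : ℕ} {c : ℝ} (hN : ∫ θ, f N θ ∂m < N * c) :
    ∀ᵐ θ ∂m, BddAbove (range fun n : ℕ => f n θ - n * c) := by
  have hup (n : ℕ) (θ : Θ) : f n θ ≤ n * L := by
    induction n with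
    | zero => simp [hf0]
    | succ n ih =>
      have h1 := hsub n 1 θ
      have h2 := hL (T^[n] θ)
      push_cast
      linarith
  have hN0 : 0 < N := by
    rcases Nat.eq_zero_or_pos N with rfl | h
    · simp [hf0] at hN
    · exact h
  set φ : Θ → ℝ := fun θ => f N θ - N * c with hφdef
  have hφ : Measurable φ := (hf N).sub measurable_const
  have hfint : Integrable (f N) m := by
    refine Integrable.of_bound (hf N).aestronglyMeasurable (N * L) (.of_forall fun θ => ?_)
    rw [Real.norm_of_nonneg (hpos N θ)]
    exact hup N θ
  have hD (θ : Θ) : |φ θ| ≤ N * L + |N * c| := by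
    refine (abs_sub _ _).trans ?_
    rw [abs_of_nonneg (hpos N θ)]
    linarith [hup N θ]
  have hneg : ∫ θ, φ θ ∂m < 0 := by
    rw [hφdef, integral_sub hfint (integrable_const _)]
    simpa using hN
  have hkN (k : ℕ) (θ : Θ) : f (k * N) θ - (k * N : ℕ) * c ≤ posPartMax T^[N] φ k θ := by
    induction k generalizing θ with
    | zero => simp [hf0, posPartMax]
    | succ k ih =>
      refine le_trans ?_ (le_max_right _ _)
      have h1 := hsub N (k * N) θ
      have h2 := ih (T^[N] θ)
      rw [show (k + 1) * N = N + k * N by ring]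
      push_cast at h2 ⊢
      simp only [hφdef]
      linarith
  set E : Set Θ := {θ | BddAbove (range fun n : ℕ => f n θ - n * c)}ᶜ with hE
  have hEmeas : MeasurableSet E :=
    (measurableSet_bddAbove_range fun n => (hf n).sub measurable_const).compl
  have hET : E ⊆ T ⁻¹' E := by
    rw [hE, preimage_compl, compl_subset_compl]
    rintro θ ⟨K, hK⟩
    refine ⟨max 0 (L + K - c), ?_⟩
    rintro _ ⟨n, rfl⟩
    cases n with
    | zero => simp [hf0]
    | succ n =>
      have h1 := hsub 1 n θ
      have h2 : f n (T θ) - n * c ≤ K := hK ⟨n, rfl⟩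
      have h3 := hL θ
      refine le_trans ?_ (le_max_right _ _)
      rw [add_comm 1 n] at h1
      simp only [Function.iterate_one] at h1
      push_cast
      linarith
  rcases hT.ae_empty_or_univ_of_ae_le_preimage hEmeas.nullMeasurableSet
    (LE.le.eventuallyLE hET) with h0 | h1
  · have := ae_eq_empty.1 h0
    rwa [hE] at this
  · refine absurd (integral_nonneg_of_tendsto_posPartMax (hT.toMeasurePreserving.iterate N)
      hφ hD ?_) (not_le.2 hneg)
    filter_upwards [eventuallyEq_univ.1 h1] with θ hθ
    refine tendsto_atTop_atTop_of_monotone (monotone_nat_of_le_succ fun n =>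
      posPartMax_le_succ n θ) fun b => ?_
    by_contra! hcon
    refine hθ ⟨b + N * (L + |c|), ?_⟩
    rintro _ ⟨n, rfl⟩
    have hL0 : 0 ≤ L := (hpos 1 θ).trans (hL θ)
    have h1 := hsub (n / N * N) (n % N) θ
    rw [Nat.div_add_mod'] at h1
    have h2 := hup (n % N) (T^[n / N * N] θ)
    have h3 := hkN (n / N) θ
    have h4 := hcon (n / N)
    have h5 : ((n % N : ℕ) : ℝ) ≤ N := by exact_mod_cast (Nat.mod_lt n hN0).le
    have h6 : (n : ℝ) = (n / N * N : ℕ) + (n % N : ℕ) := by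
      exact_mod_cast (Nat.div_add_mod' n N).symm
    have h7 : -((n % N : ℕ) : ℝ) * c ≤ N * |c| := by
      nlinarith [neg_le_abs c, abs_nonneg c, (Nat.cast_nonneg (n % N) : (0 : ℝ) ≤ _)]
    have h8 : ((n % N : ℕ) : ℝ) * L ≤ N * L := mul_le_mul_of_nonneg_right h5 hL0
    simp only
    rw [h6]
    linarith

end PosPartMax

section Matrices

lemma mulVecE_eq_toEuclideanCLM (M : Matrix (Fin 2) (Fin 2) ℝ) (v : R2) :
    mulVecE M v = Matrix.toEuclideanCLM (𝕜 := ℝ) M v := rfl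

lemma norm_mulVecE_le (M : Matrix (Fin 2) (Fin 2) ℝ) (v : R2) :
    ‖mulVecE M v‖ ≤ opNorm M * ‖v‖ :=
  (Matrix.toEuclideanCLM (𝕜 := ℝ) M : R2 →L[ℝ] R2).le_opNorm v

lemma mulVecE_smul (M : Matrix (Fin 2) (Fin 2) ℝ) (a : ℝ) (v : R2) :
    mulVecE M (a • v) = a • mulVecE M v := by
  simp only [mulVecE_eq_toEuclideanCLM, map_smul]

lemma mulVecE_mul (M N : Matrix (Fin 2) (Fin 2) ℝ) (v : R2) :
    mulVecE (M * N) v = mulVecE M (mulVecE N v) := by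
  simp only [mulVecE_eq_toEuclideanCLM, map_mul, mul_apply_eq_comp]

lemma mulVecE_one (v : R2) : mulVecE 1 v = v := by
  simp [mulVecE_eq_toEuclideanCLM]

lemma opNorm_nonneg (M : Matrix (Fin 2) (Fin 2) ℝ) : 0 ≤ opNorm M := norm_nonneg _

lemma opNorm_one : opNorm 1 = 1 := by
  simp [opNorm]

lemma opNorm_mul_le (M N : Matrix (Fin 2) (Fin 2) ℝ) :
    opNorm (M * N) ≤ opNorm M * opNorm N := by
  simp only [opNorm, map_mul]
  exact norm_mul_le _ _

lemma opNorm_transpose (M : Matrix (Fin 2) (Fin 2) ℝ) : opNorm M.transpose = opNorm M := by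
  rw [opNorm, ← Matrix.conjTranspose_eq_transpose_of_trivial, ← Matrix.star_eq_conjTranspose,
    map_star]
  exact norm_star (Matrix.toEuclideanCLM (𝕜 := ℝ) M : R2 →L[ℝ] R2)

lemma opNorm_le_one_of_norm_mulVecE {M : Matrix (Fin 2) (Fin 2) ℝ}
    (hM : ∀ v, ‖mulVecE M v‖ = ‖v‖) : opNorm M ≤ 1 :=
  ContinuousLinearMap.opNorm_le_bound _ zero_le_one fun v => by
    rw [one_mul, ← hM v, mulVecE_eq_toEuclideanCLM]

lemma opNorm_adjugate_le (M : Matrix (Fin 2) (Fin 2) ℝ) : opNorm M.adjugate ≤ opNorm M := by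
  have hrot : M.adjugate = !![0, 1; -1, 0] * M.transpose * !![0, -1; 1, 0] := by
    ext i j
    fin_cases i <;> fin_cases j <;>
      simp [Matrix.adjugate_fin_two, Matrix.vecMul, dotProduct, Matrix.mul_apply]
  have h1 : opNorm !![0, 1; -1, 0] ≤ 1 := opNorm_le_one_of_norm_mulVecE fun v => by
    simp [mulVecE, EuclideanSpace.norm_eq, Fin.sum_univ_two, dotProduct, add_comm]
  have h2 : opNorm !![0, -1; 1, 0] ≤ 1 := opNorm_le_one_of_norm_mulVecE fun v => by
    simp [mulVecE, EuclideanSpace.norm_eq, Fin.sum_univ_two, dotProduct, add_comm]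
  calc opNorm M.adjugate
      ≤ opNorm !![0, 1; -1, 0] * opNorm M.transpose * opNorm !![0, -1; 1, 0] := by
        rw [hrot]
        exact (opNorm_mul_le _ _).trans
          (mul_le_mul_of_nonneg_right (opNorm_mul_le _ _) (opNorm_nonneg _))
    _ ≤ 1 * opNorm M * 1 := by
        rw [opNorm_transpose]
        have := opNorm_nonneg M
        have := opNorm_nonneg !![0, -1; 1, 0]
        gcongr
    _ = opNorm M := by ring

lemma opNorm_inv_of_det_eq_one {M : Matrix (Fin 2) (Fin 2) ℝ} (hM : M.det = 1) :
    opNorm M⁻¹ = opNorm M := by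
  have h : M⁻¹ = M.adjugate := by simp [Matrix.inv_def, hM]
  rw [h]
  refine (opNorm_adjugate_le M).antisymm ?_
  have := opNorm_adjugate_le M.adjugate
  rwa [Matrix.adjugate_adjugate M (by simp), Fintype.card_fin, pow_zero, one_smul] at this

lemma one_le_opNorm_of_det_eq_one {M : Matrix (Fin 2) (Fin 2) ℝ} (hM : M.det = 1) :
    1 ≤ opNorm M := by
  have h := opNorm_mul_le M M⁻¹
  rw [Matrix.mul_nonsing_inv M (by simp [hM]), opNorm_one, opNorm_inv_of_det_eq_one hM] at h
  nlinarith [opNorm_nonneg M]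

lemma mulVecE_ne_zero_of_det_eq_one {M : Matrix (Fin 2) (Fin 2) ℝ} (hM : M.det = 1) {v : R2}
    (hv : v ≠ 0) : mulVecE M v ≠ 0 := by
  intro h
  apply hv
  rw [← mulVecE_one v, ← Matrix.nonsing_inv_mul M (by simp [hM]), mulVecE_mul, h,
    mulVecE_eq_toEuclideanCLM, map_zero]

lemma measurable_opNorm {Θ : Type*} [MeasurableSpace Θ] {M : Θ → Matrix (Fin 2) (Fin 2) ℝ}
    (hM : ∀ i j, Measurable fun θ => M θ i j) : Measurable fun θ => opNorm (M θ) := by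
  have hlin : Continuous fun g : Fin 2 → Fin 2 → ℝ =>
      (Matrix.toEuclideanCLM (𝕜 := ℝ) (Matrix.of g) : R2 →L[ℝ] R2) :=
    LinearMap.continuous_of_finiteDimensional
      ((Matrix.toEuclideanCLM (n := Fin 2) (𝕜 := ℝ)).toAlgEquiv.toLinearMap ∘ₗ
        (Matrix.ofLinearEquiv ℝ).toLinearMap)
  exact hlin.norm.measurable.comp
    (measurable_pi_iff.2 fun i => measurable_pi_iff.2 fun j => hM i j)

end Matrices

section Angles

lemma norm_vHalf (α : ℝ) : ‖vHalf α‖ = 1 := by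
  simp [vHalf, EuclideanSpace.norm_eq, Fin.sum_univ_two]

lemma vHalf_ne_zero (α : ℝ) : vHalf α ≠ 0 := by
  rw [← norm_ne_zero_iff, norm_vHalf]
  exact one_ne_zero

lemma vHalf_add_one (α : ℝ) : vHalf (α + 1) = (-1 : ℝ) • vHalf α := by
  ext i
  fin_cases i <;> simp [vHalf, mul_add, Real.cos_add_pi, Real.sin_add_pi]

lemma continuous_vHalf : Continuous vHalf := by
  refine (PiLp.continuous_toLp 2 _).comp (continuous_pi fun i => ?_)
  fin_cases i
  · exact Real.continuous_cos.comp (continuous_const.mul continuous_id)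
  · exact Real.continuous_sin.comp (continuous_const.mul continuous_id)

lemma vHalf_projAngle {w : R2} (hw : w ≠ 0) :
    ∃ ε : ℝ, |ε| = 1 ∧ vHalf (projAngle w) = (ε / ‖w‖) • w := by
  set z : ℂ := Complex.ofReal (w 0) + Complex.ofReal (w 1) * Complex.I with hz
  have hre : z.re = w 0 := by simp [hz]
  have him : z.im = w 1 := by simp [hz]
  have hnorm : ‖z‖ = ‖w‖ := by
    rw [Complex.norm_eq_sqrt_sq_add_sq, hre, him, EuclideanSpace.norm_eq, Fin.sum_univ_two]
    simp
  have hz0 : z ≠ 0 := by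
    rw [← norm_ne_zero_iff, hnorm]
    exact norm_ne_zero_iff.2 hw
  have hangle : Real.pi * projAngle w = z.arg - ⌊z.arg / Real.pi⌋ * Real.pi := by
    rw [projAngle, ← hz, Int.fract]
    field_simp
  refine ⟨(-1) ^ ⌊z.arg / Real.pi⌋, by simp [abs_zpow], ?_⟩
  ext i
  fin_cases i
  · simp [vHalf, hangle, Real.cos_sub_int_mul_pi, Complex.cos_arg hz0, hre, hnorm]
    ring
  · simp [vHalf, hangle, Real.sin_sub_int_mul_pi, Complex.sin_arg, him, hnorm]
    ring

end Angles

lemma GoodH.exists_mul_le {h : ℝ → ℝ} (hh : GoodH h) {b β : ℝ} (hb : 0 < b) (hbβ : b < β) :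
    ∃ r₀ : ℝ, 0 < r₀ ∧ r₀ ≤ 1 ∧ ∀ r, 0 ≤ r → r ≤ r₀ → b * r ≤ h (β * r) := by
  obtain ⟨-, -, -, -, -, h0, hd⟩ := hh
  have hβ : 0 < β := hb.trans hbβ
  have hderiv : HasDerivWithinAt h 1 (Ici 0) 0 := by
    rw [← hd]
    exact (differentiableWithinAt_of_derivWithin_ne_zero (hd ▸ one_ne_zero)).hasDerivWithinAt
  rw [hasDerivWithinAt_iff_tendsto_slope, Ici_sdiff_left] at hderiv
  have hev := hderiv.eventually (lt_mem_nhds ((div_lt_one hβ).2 hbβ))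
  obtain ⟨δ, hδ, hsub⟩ := mem_nhdsGT_iff_exists_Ioc_subset.1 hev
  have hδ' : 0 < δ := hδ
  refine ⟨min 1 (δ / β), by positivity, min_le_left _ _, fun r hr0 hr => ?_⟩
  rcases hr0.eq_or_lt with rfl | hr0
  · simp [h0]
  have hx : 0 < β * r := by positivity
  have hxδ : β * r ≤ δ := by
    have := hr.trans (min_le_right _ _)
    rwa [le_div_iff₀ hβ, mul_comm] at this
  have hs : b / β < slope h 0 (β * r) := hsub ⟨hx, hxδ⟩
  rw [slope_def_field, h0, sub_zero, sub_zero, lt_div_iff₀ hx] at hs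
  calc b * r = b / β * (β * r) := by field_simp
    _ ≤ h (β * r) := hs.le

section Cocycles

variable {Θ : Type*}

lemma coc_add (T : Θ → Θ) (B : Θ → Matrix (Fin 2) (Fin 2) ℝ) (n k : ℕ) (θ : Θ) :
    coc T B (n + k) θ = coc T B k (T^[n] θ) * coc T B n θ := by
  induction n generalizing θ with
  | zero => simp [coc]
  | succ n ih =>
    rw [show n + 1 + k = (n + k) + 1 by ring]
    simp only [coc, Function.iterate_succ_apply, ih, mul_assoc]

lemma det_coc (T : Θ → Θ) {B : Θ → Matrix (Fin 2) (Fin 2) ℝ} (hB : ∀ θ, (B θ).det = 1)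
    (n : ℕ) (θ : Θ) : (coc T B n θ).det = 1 := by
  induction n generalizing θ with
  | zero => simp [coc]
  | succ n ih => simp [coc, Matrix.det_mul, ih, hB]

lemma measurable_coc [MeasurableSpace Θ] {T : Θ → Θ} (hT : Measurable T)
    {B : Θ → Matrix (Fin 2) (Fin 2) ℝ} (hB : ∀ i j, Measurable fun θ => B θ i j) (n : ℕ)
    (i j : Fin 2) : Measurable fun θ => coc T B n θ i j := by
  induction n generalizing i j with
  | zero => exact measurable_const
  | succ n ih =>
    simp only [coc, Matrix.mul_apply, Fin.sum_univ_two]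
    exact (((ih i 0).comp hT).mul (hB 0 j)).add (((ih i 1).comp hT).mul (hB 1 j))

/-- The backward cocycle `A(γ⁻ⁿθ)⁻¹ ⋯ A(γ⁻¹θ)⁻¹`. -/
def backCoc (γ : Θ ≃ Θ) (A : Θ → Matrix (Fin 2) (Fin 2) ℝ) (n : ℕ) (θ : Θ) :
    Matrix (Fin 2) (Fin 2) ℝ :=
  coc γ.symm (fun θ => (A (γ.symm θ))⁻¹) n θ

variable {γ : Θ ≃ Θ} {A : Θ → Matrix (Fin 2) (Fin 2) ℝ}

lemma backCoc_mul_coc (hdet : ∀ θ, (A θ).det = 1) (n : ℕ) (θ : Θ) :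
    backCoc γ A n θ * coc γ A n (γ.symm^[n] θ) = 1 := by
  induction n generalizing θ with
  | zero => simp [backCoc, coc]
  | succ n ih =>
    have hcancel : γ^[n] (γ.symm^[n] (γ.symm θ)) = γ.symm θ :=
      (Function.LeftInverse.iterate γ.apply_symm_apply n) _
    have hinv : (A (γ.symm θ))⁻¹ * A (γ.symm θ) = 1 :=
      Matrix.nonsing_inv_mul _ (by simp [hdet])
    have h := ih (γ.symm θ)
    simp only [backCoc] at h ⊢
    rw [Function.iterate_succ_apply, coc_add γ A n 1, hcancel]
    simp only [coc, one_mul]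
    rw [mul_assoc, ← mul_assoc _ (A _), hinv, one_mul, h]

lemma det_backCoc (hdet : ∀ θ, (A θ).det = 1) (n : ℕ) (θ : Θ) : (backCoc γ A n θ).det = 1 :=
  det_coc _ (fun θ => by simp [Matrix.det_nonsing_inv, hdet]) n θ

lemma opNorm_backCoc (hdet : ∀ θ, (A θ).det = 1) (n : ℕ) (θ : Θ) :
    opNorm (backCoc γ A n θ) = opNorm (coc γ A n (γ.symm^[n] θ)) := by
  rw [← Matrix.inv_eq_left_inv (backCoc_mul_coc hdet n θ),
    opNorm_inv_of_det_eq_one (det_coc _ hdet _ _)]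

lemma backCoc_succ_apply (n : ℕ) (θ : Θ) :
    backCoc γ A (n + 1) (γ θ) = backCoc γ A n θ * (A θ)⁻¹ := by
  simp [backCoc, coc]

lemma measurable_backCoc [MeasurableSpace Θ] (hγ' : Measurable γ.symm)
    (hdet : ∀ θ, (A θ).det = 1) (hA : ∀ i j, Measurable fun θ => A θ i j) (n : ℕ) (i j : Fin 2) :
    Measurable fun θ => backCoc γ A n θ i j := by
  refine measurable_coc hγ' (fun i j => ?_) n i j
  have hinv (θ : Θ) : (A (γ.symm θ))⁻¹ = (A (γ.symm θ)).adjugate := by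
    simp [Matrix.inv_def, hdet]
  simp only [hinv, Matrix.adjugate_fin_two]
  fin_cases i <;> fin_cases j <;> simp
  · exact (hA 1 1).comp hγ'
  · exact (hA 0 1).comp hγ'
  · exact (hA 1 0).comp hγ'
  · exact (hA 0 0).comp hγ'

/-- The backward cocycle almost surely grows at most like `bⁿ` for every `b` above the exponential
of the Lyapunov exponent. -/
lemma ae_exists_opNorm_backCoc_le [MeasurableSpace Θ] (hγ : Measurable γ)
    (hγ' : Measurable γ.symm) {m : Measure Θ} [IsProbabilityMeasure m] (herg : Ergodic γ m)
    (hdet : ∀ θ, (A θ).det = 1) (hA : ∀ i j, Measurable fun θ => A θ i j)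
    (hAbdd : ∃ C : ℝ, ∀ θ, opNorm (A θ) ≤ C) {lam : ℝ}
    (hlam : Tendsto (fun n : ℕ => (∫ θ, Real.log (opNorm (coc γ A n θ)) ∂m) / n)
      atTop (𝓝 lam)) {c : ℝ} (hc : lam < c) :
    ∀ᵐ θ ∂m, ∃ K : ℝ, ∀ n, opNorm (backCoc γ A n θ) ≤ K * Real.exp c ^ n := by
  obtain ⟨C, hC⟩ := hAbdd
  have hsymm : Ergodic γ.symm m :=
    Ergodic.symm (e := { γ with measurable_toFun := hγ, measurable_invFun := hγ' }) herg
  have hone (n : ℕ) (θ : Θ) : 1 ≤ opNorm (backCoc γ A n θ) :=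
    one_le_opNorm_of_det_eq_one (det_backCoc hdet n θ)
  obtain ⟨N, hNc, hN0⟩ := ((hlam.eventually (gt_mem_nhds hc)).and (eventually_gt_atTop 0)).exists
  have hN : ∫ θ, Real.log (opNorm (backCoc γ A N θ)) ∂m < N * c := by
    have hmp := hsymm.toMeasurePreserving.iterate N
    have hmeas : Measurable fun θ => Real.log (opNorm (coc γ A N θ)) :=
      Real.measurable_log.comp (measurable_opNorm (measurable_coc hγ hA N))
    have hint : ∫ θ, Real.log (opNorm (backCoc γ A N θ)) ∂m =
        ∫ θ, Real.log (opNorm (coc γ A N θ)) ∂m := by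
      conv_rhs => rw [← hmp.map_eq]
      rw [integral_map hmp.aemeasurable hmeas.aestronglyMeasurable]
      simp only [opNorm_backCoc hdet]
    rw [hint, mul_comm]
    exact (div_lt_iff₀ (by exact_mod_cast hN0)).1 hNc
  have hbdd := ae_bddAbove_sub_of_subadditive hsymm
    (f := fun n θ => Real.log (opNorm (backCoc γ A n θ))) (L := Real.log C)
    (fun n => Real.measurable_log.comp (measurable_opNorm (measurable_backCoc hγ' hdet hA n)))
    (fun θ => by simp [backCoc, coc, opNorm_one])
    (fun n θ => Real.log_nonneg (hone n θ))
    (fun θ => Real.log_le_log (zero_lt_one.trans_le (hone 1 θ))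
      (by simpa [opNorm_backCoc hdet, coc] using hC (γ.symm θ)))
    (fun n k θ => by
      rw [← Real.log_mul (zero_lt_one.trans_le (hone _ _)).ne'
        (zero_lt_one.trans_le (hone _ _)).ne']
      refine Real.log_le_log (zero_lt_one.trans_le (hone _ _)) ?_
      rw [backCoc, coc_add]
      exact (opNorm_mul_le _ _).trans_eq (mul_comm _ _)) hN
  filter_upwards [hbdd] with θ ⟨K, hK⟩
  refine ⟨Real.exp K, fun n => ?_⟩
  have h : Real.log (opNorm (backCoc γ A n θ)) - n * c ≤ K := hK ⟨n, rfl⟩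
  rw [← Real.exp_nat_mul, ← Real.exp_add,
    ← Real.log_le_iff_le_exp (zero_lt_one.trans_le (hone n θ))]
  linarith

/-- The gauge `sup_n ‖A₋ₙ(θ) v‖ / bⁿ`, which is adapted to the backward cocycle. -/
def backGauge (γ : Θ ≃ Θ) (A : Θ → Matrix (Fin 2) (Fin 2) ℝ) (b : ℝ) (θ : Θ) (v : R2) : ℝ :=
  ⨆ n : ℕ, ‖mulVecE (backCoc γ A n θ) v‖ / b ^ n

lemma backGauge_smul {b : ℝ} (a : ℝ) (θ : Θ) (v : R2) :
    backGauge γ A b θ (a • v) = |a| * backGauge γ A b θ v := by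
  simp only [backGauge, mulVecE_smul, norm_smul, Real.norm_eq_abs, mul_div_assoc]
  exact (Real.mul_iSup_of_nonneg (abs_nonneg a) _).symm

lemma norm_le_backGauge {b : ℝ} {θ : Θ} {v : R2}
    (hbdd : BddAbove (range fun n : ℕ => ‖mulVecE (backCoc γ A n θ) v‖ / b ^ n)) :
    ‖v‖ ≤ backGauge γ A b θ v := by
  have h : _ ≤ backGauge γ A b θ v := le_ciSup hbdd 0
  simpa [backCoc, coc, mulVecE_one] using h

lemma norm_le_backGauge_or_eq_zero (b : ℝ) (θ : Θ) (v : R2) :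
    ‖v‖ ≤ backGauge γ A b θ v ∨ backGauge γ A b θ v = 0 := by
  by_cases hbdd : BddAbove (range fun n : ℕ => ‖mulVecE (backCoc γ A n θ) v‖ / b ^ n)
  · exact .inl (norm_le_backGauge hbdd)
  · exact .inr (Real.iSup_of_not_bddAbove hbdd)

/-- If the gauge is finite along the image of `v`, then it decreases by at most the factor `b`. -/
lemma backGauge_le_mul (hdet : ∀ θ, (A θ).det = 1) {b : ℝ} (hb : 0 < b) {θ : Θ} {v : R2}
    (hv : v ≠ 0) (hne : backGauge γ A b (γ θ) (mulVecE (A θ) v) ≠ 0) :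
    0 < backGauge γ A b θ v ∧
      backGauge γ A b θ v ≤ b * backGauge γ A b (γ θ) (mulVecE (A θ) v) := by
  have hbdd : BddAbove (range fun n : ℕ =>
      ‖mulVecE (backCoc γ A n (γ θ)) (mulVecE (A θ) v)‖ / b ^ n) :=
    not_imp_comm.1 Real.iSup_of_not_bddAbove hne
  have hstep (n : ℕ) : ‖mulVecE (backCoc γ A n θ) v‖ / b ^ n ≤
      b * backGauge γ A b (γ θ) (mulVecE (A θ) v) := by
    have h : ‖mulVecE (backCoc γ A (n + 1) (γ θ)) (mulVecE (A θ) v)‖ / b ^ (n + 1) ≤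
        backGauge γ A b (γ θ) (mulVecE (A θ) v) := le_ciSup hbdd (n + 1)
    rw [backCoc_succ_apply, ← mulVecE_mul, mul_assoc,
      Matrix.nonsing_inv_mul _ (by simp [hdet]), mul_one] at h
    calc ‖mulVecE (backCoc γ A n θ) v‖ / b ^ n
        = b * (‖mulVecE (backCoc γ A n θ) v‖ / b ^ (n + 1)) := by
          rw [pow_succ]
          field_simp
      _ ≤ _ := mul_le_mul_of_nonneg_left h hb.le
  exact ⟨(norm_pos_iff.2 hv).trans_le (norm_le_backGauge ⟨_, forall_mem_range.2 hstep⟩),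
    ciSup_le hstep⟩

lemma measurable_backGauge [MeasurableSpace Θ] (hγ' : Measurable γ.symm)
    (hdet : ∀ θ, (A θ).det = 1) (hA : ∀ i j, Measurable fun θ => A θ i j) (b : ℝ) :
    Measurable fun p : Θ × ℝ => backGauge γ A b p.1 (vHalf p.2) := by
  refine Measurable.iSup fun n => Measurable.div_const (Measurable.norm ?_) _
  refine (PiLp.continuous_toLp 2 _).measurable.comp (measurable_pi_iff.2 fun i => ?_)
  simp only [Matrix.mulVec, dotProduct]
  refine Finset.measurable_sum _ fun j _ =>
    ((measurable_backCoc hγ' hdet hA n i j).comp measurable_fst).mul ?_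
  exact ((PiLp.continuous_ofLp 2 _).comp continuous_vHalf).measurable.comp measurable_snd |>.eval

lemma bddAbove_backGauge {b : ℝ} (hb : 0 < b) {θ : Θ} {K : ℝ}
    (hK : ∀ n, opNorm (backCoc γ A n θ) ≤ K * b ^ n) (v : R2) :
    (∀ n : ℕ, ‖mulVecE (backCoc γ A n θ) v‖ / b ^ n ≤ K * ‖v‖) ∧
      BddAbove (range fun n : ℕ => ‖mulVecE (backCoc γ A n θ) v‖ / b ^ n) := by
  have h (n : ℕ) : ‖mulVecE (backCoc γ A n θ) v‖ / b ^ n ≤ K * ‖v‖ := by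
    rw [div_le_iff₀ (by positivity), mul_right_comm]
    exact (norm_mulVecE_le _ _).trans (mul_le_mul_of_nonneg_right (hK n) (norm_nonneg v))
  exact ⟨h, _, forall_mem_range.2 h⟩

lemma continuous_backGauge {b : ℝ} (hb : 0 < b) {θ : Θ} {K : ℝ}
    (hK : ∀ n, opNorm (backCoc γ A n θ) ≤ K * b ^ n) : Continuous (backGauge γ A b θ) := by
  have hK0 : 0 ≤ K := by
    have h := (opNorm_nonneg _).trans (hK 0)
    simpa using h
  refine (LipschitzWith.of_le_add_mul ⟨K, hK0⟩ fun v w => ciSup_le fun n => ?_).continuous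
  have hsplit : mulVecE (backCoc γ A n θ) v =
      mulVecE (backCoc γ A n θ) w + mulVecE (backCoc γ A n θ) (v - w) := by
    simp only [mulVecE_eq_toEuclideanCLM, map_sub, add_sub_cancel]
  calc ‖mulVecE (backCoc γ A n θ) v‖ / b ^ n
      ≤ ‖mulVecE (backCoc γ A n θ) w‖ / b ^ n +
          ‖mulVecE (backCoc γ A n θ) (v - w)‖ / b ^ n := by
        rw [hsplit, ← add_div]
        gcongr
        exact norm_add_le _ _
    _ ≤ backGauge γ A b θ w + K * dist v w := by
        rw [dist_eq_norm]
        exact add_le_add (le_ciSup (bddAbove_backGauge hb hK w).2 n)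
          ((bddAbove_backGauge hb hK _).1 n)

end Cocycles

/-- If `β > β₂^m = e^{λ_m(A)}`, there is a measurable
`Δ_β : Θ×𝕋 → [0,1]` with `F_{β,θ,α}(Δ_β(θ,α)) ≥ Δ_β(g(θ,α))` for all θ, α, such that
for m-a.e. θ the map `α ↦ Δ_β(θ,α)` is continuous and strictly positive. -/
theorem stmt19 {Θ : Type*} [MeasurableSpace Θ]
    (γ : Θ ≃ Θ) (hγ : Measurable ⇑γ) (hγ' : Measurable ⇑γ.symm)
    (m : Measure Θ) [IsProbabilityMeasure m] (herg : Ergodic ⇑γ m)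
    (A : Θ → Matrix (Fin 2) (Fin 2) ℝ) (hdet : ∀ θ, (A θ).det = 1)
    (hAmeas : ∀ i j, Measurable fun θ => A θ i j)
    (hAbdd : ∃ C : ℝ, ∀ θ, opNorm (A θ) ≤ C)
    (h : ℝ → ℝ) (hh : GoodH h) (hscale : Scaled A h)
    (lam : ℝ)
    (hlam : Filter.Tendsto
      (fun n : ℕ => (∫ θ, Real.log (opNorm (coc ⇑γ A n θ)) ∂m) / n)
      Filter.atTop (𝓝 lam))
    (β : ℝ) (hβ : Real.exp lam < β) :
    ∃ Δ : Θ × ℝ → ℝ,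
      Measurable Δ ∧
      (∀ p : Θ × ℝ, Δ p ∈ Set.Icc (0 : ℝ) 1) ∧
      (∀ θ α, Δ (θ, α + 1) = Δ (θ, α)) ∧
      (∀ θ : Θ, ∀ α : ℝ, Δ (gMap ⇑γ A (θ, α)) ≤ dsFib A h β (θ, α) (Δ (θ, α))) ∧
      (∀ᵐ θ ∂m, (Continuous fun α : ℝ => Δ (θ, α)) ∧ ∀ α : ℝ, 0 < Δ (θ, α)) := by
  have hβ0 : 0 < β := (Real.exp_pos _).trans hβ
  obtain ⟨c, hlc, hcβ⟩ := exists_between ((Real.lt_log_iff_exp_lt hβ0).2 hβ)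
  have hb : 0 < Real.exp c := Real.exp_pos c
  obtain ⟨r₀, hr₀, hr₀1, hr⟩ := hh.exists_mul_le hb ((Real.lt_log_iff_exp_lt hβ0).1 hcβ)
  set P : Θ → R2 → ℝ := backGauge γ A (Real.exp c) with hP
  have hP_cases (θ : Θ) (α : ℝ) : 1 ≤ P θ (vHalf α) ∨ P θ (vHalf α) = 0 := by
    rw [← norm_vHalf α]
    exact norm_le_backGauge_or_eq_zero _ θ (vHalf α)
  have hrange (θ : Θ) (α : ℝ) : 0 ≤ r₀ / P θ (vHalf α) ∧ r₀ / P θ (vHalf α) ≤ r₀ := by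
    rcases hP_cases θ α with h1 | h0
    · exact ⟨by positivity, div_le_self hr₀.le h1⟩
    · simp [h0, hr₀.le]
  have hP_meas : Measurable fun p : Θ × ℝ => P p.1 (vHalf p.2) :=
    measurable_backGauge hγ' hdet hAmeas _
  refine ⟨fun p => r₀ / P p.1 (vHalf p.2), hP_meas.const_div r₀,
    fun p => ⟨(hrange _ _).1, (hrange _ _).2.trans hr₀1⟩, fun θ α => ?_, fun θ α => ?_, ?_⟩
  · simp only [vHalf_add_one, hP, backGauge_smul, abs_neg, abs_one, one_mul]
  · set w := mulVecE (A θ) (vHalf α) with hw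
    have hw0 : w ≠ 0 := mulVecE_ne_zero_of_det_eq_one (hdet θ) (vHalf_ne_zero α)
    obtain ⟨ε, hε, hangle⟩ := vHalf_projAngle hw0
    have hwpos : 0 < ‖w‖ := norm_pos_iff.2 hw0
    have himage : P (γ θ) (vHalf (projAngle w)) = P (γ θ) w / ‖w‖ := by
      rw [hangle, hP, backGauge_smul, abs_div, hε, abs_norm]
      ring
    have hlin : Real.exp c * (r₀ / P θ (vHalf α)) * ‖w‖ ≤
        h (β * (r₀ / P θ (vHalf α))) * ‖w‖ :=
      mul_le_mul_of_nonneg_right (hr _ (hrange θ α).1 (hrange θ α).2) hwpos.le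
    refine le_trans ?_ hlin
    change r₀ / P (γ θ) (vHalf (projAngle w)) ≤ _
    rw [himage]
    by_cases hne : P (γ θ) w = 0
    · have := (hrange θ α).1
      rw [hne, zero_div, div_zero]
      positivity
    · obtain ⟨hpos, hle⟩ := backGauge_le_mul hdet hb (vHalf_ne_zero α) hne
      have hpos' : 0 < P (γ θ) w := pos_of_mul_pos_right (hpos.trans_le hle) hb.le
      rw [div_div_eq_mul_div, mul_div_assoc', div_mul_eq_mul_div, div_le_div_iff₀ hpos' hpos]
      have := mul_le_mul_of_nonneg_left hle (mul_pos hr₀ hwpos).le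
      linarith
  · filter_upwards [ae_exists_opNorm_backCoc_le hγ hγ' herg hdet hAmeas hAbdd hlam hlc]
      with θ ⟨K, hK⟩
    have hpos (α : ℝ) : 0 < P θ (vHalf α) := by
      have h1 := norm_le_backGauge (bddAbove_backGauge hb hK (vHalf α)).2
      rw [norm_vHalf] at h1
      exact zero_lt_one.trans_le h1
    exact ⟨continuous_const.div ((continuous_backGauge hb hK).comp continuous_vHalf)
      fun α => (hpos α).ne', fun α => div_pos hr₀ (hpos α)⟩
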